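/- arXiv:1807.10098 — 2 statements merged into one kernel-verified Lean document; each statement's English description precedes it below -/
import Mathlib

section
/- Let λ ≥ 0, β ≥ 0 and γ > 0. Then there exists a unique function u ∈ C²([0,+∞)) with u(0) = γ and u'(0) = 0 solving u''(r) + u'(r)/r = −(λ u(r) + β u(r) exp(u(r)²)) for all r > 0; that is, the radially symmetric solution of Δu = λu + βu exp(u²) with central value γ is defined on all of ℝ². -/
open Real Set Filter MeasureTheory

/-- Half the mean value of `x ↦ h ‖x‖` over the disc of radius `r` in the plane. -/
noncomputable def discMean (h : ℝ → ℝ) (r : ℝ) : ℝ := ∫ s in (0 : ℝ)..1, s * h (r * s)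

lemma continuous_discMean {h : ℝ → ℝ} (hh : Continuous h) : Continuous (discMean h) := by
  unfold discMean
  apply intervalIntegral.continuous_parametric_intervalIntegral_of_continuous'
  fun_prop

lemma discMean_sub {h₁ h₂ : ℝ → ℝ} (hh₁ : Continuous h₁) (hh₂ : Continuous h₂) (r : ℝ) :
    discMean (fun t => h₁ t - h₂ t) r = discMean h₁ r - discMean h₂ r := by
  unfold discMean
  rw [← intervalIntegral.integral_sub]
  · simp only [mul_sub]
  · exact Continuous.intervalIntegrable (by fun_prop) _ _
  · exact Continuous.intervalIntegrable (by fun_prop) _ _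

lemma sq_mul_discMean (h : ℝ → ℝ) (r : ℝ) :
    r ^ 2 * discMean h r = ∫ t in (0 : ℝ)..r, t * h t := by
  have key := intervalIntegral.mul_integral_comp_mul_left (a := (0 : ℝ)) (b := 1)
    (f := fun t => t * h t) r
  simp only [mul_zero, mul_one] at key
  rw [← key, discMean, sq, mul_assoc, ← intervalIntegral.integral_const_mul]
  simp only [mul_assoc]

lemma hasDerivAt_sq_mul_discMean {h : ℝ → ℝ} (hh : Continuous h) (r : ℝ) :
    HasDerivAt (fun r => r ^ 2 * discMean h r) (r * h r) r := by
  simp only [sq_mul_discMean]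
  have hc : Continuous fun t => t * h t := by fun_prop
  exact intervalIntegral.integral_hasDerivAt_right (hc.intervalIntegrable _ _)
    hc.stronglyMeasurable.stronglyMeasurableAtFilter hc.continuousAt

lemma discMean_zero (h : ℝ → ℝ) : discMean h 0 = h 0 / 2 := by
  simp [discMean, intervalIntegral.integral_mul_const]
  ring

lemma hasDerivAt_mul_discMean {h : ℝ → ℝ} (hh : Continuous h) (r : ℝ) :
    HasDerivAt (fun r => r * discMean h r) (h r - discMean h r) r := by
  rcases eq_or_ne r 0 with rfl | hr
  · have h0 : h 0 - discMean h 0 = discMean h 0 := by rw [discMean_zero]; ring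
    rw [h0, hasDerivAt_iff_tendsto_slope]
    refine ((continuous_discMean hh).tendsto 0 |>.mono_left nhdsWithin_le_nhds).congr' ?_
    filter_upwards [self_mem_nhdsWithin] with y hy
    have hy : y ≠ 0 := hy
    simp [slope_def_field, hy]
  · have key := (hasDerivAt_sq_mul_discMean hh r).div (hasDerivAt_id r) hr
    refine (key.congr_of_eventuallyEq ?_).congr_deriv ?_
    · filter_upwards [isOpen_ne.mem_nhds hr] with y hy
      have hy : y ≠ 0 := hy
      simp only [Pi.div_apply, id]
      field_simp
    · simp only [id]
      field_simp

lemma abs_discMean_le {h : ℝ → ℝ} {C k : ℝ} (hC : 0 ≤ C) (hk : 0 ≤ k)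
    (hb : ∀ t, |h t| ≤ C * exp (k * t ^ 2)) (r : ℝ) :
    |discMean h r| ≤ C * exp (k * r ^ 2) := by
  have := intervalIntegral.norm_integral_le_of_norm_le_const (a := (0 : ℝ)) (b := 1)
    (f := fun s => s * h (r * s)) (C := C * exp (k * r ^ 2)) (by
      intro s hs
      rw [uIoc_of_le zero_le_one] at hs
      have h1 : |s| ≤ 1 := abs_le.2 ⟨by linarith [hs.1], hs.2⟩
      rw [norm_mul, Real.norm_eq_abs, Real.norm_eq_abs]
      have h2 : |h (r * s)| ≤ C * exp (k * r ^ 2) := by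
        refine (hb _).trans ?_
        have : s ^ 2 ≤ 1 := by nlinarith [hs.1, hs.2]
        have : (r * s) ^ 2 ≤ r ^ 2 := by nlinarith [sq_nonneg r]
        gcongr C * exp (k * ?_)
      nlinarith [abs_nonneg s, abs_nonneg (h (r * s))])
  simpa [discMean] using this

lemma abs_sq_mul_discMean_le {h : ℝ → ℝ} {C k : ℝ} (hC : 0 ≤ C) (hk : 0 < k)
    (hb : ∀ t, |h t| ≤ C * exp (k * t ^ 2)) (r : ℝ) :
    |r ^ 2 * discMean h r| ≤ C / (2 * k) * exp (k * r ^ 2) := by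
  have hint : ∫ s in (0 : ℝ)..1, r ^ 2 * s * (C * exp (k * (r * s) ^ 2))
      = C / (2 * k) * exp (k * r ^ 2) - C / (2 * k) := by
    rw [intervalIntegral.integral_eq_sub_of_hasDerivAt
      (f := fun s => C / (2 * k) * exp (k * (r * s) ^ 2))]
    · simp
    · intro s _
      have h1 : HasDerivAt (fun s => k * (r * s) ^ 2) (k * (2 * (r * s) * r)) s := by
        have := ((((hasDerivAt_id s).const_mul r).pow 2).const_mul k)
        simpa using this
      refine (h1.exp.const_mul (C / (2 * k))).congr_deriv ?_
      field_simp
    · exact Continuous.intervalIntegrable (by fun_prop) _ _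
  have hle : ‖∫ s in (0 : ℝ)..1, r ^ 2 * (s * h (r * s))‖
      ≤ ∫ s in (0 : ℝ)..1, r ^ 2 * s * (C * exp (k * (r * s) ^ 2)) := by
    refine intervalIntegral.norm_integral_le_of_norm_le zero_le_one ?_
      (Continuous.intervalIntegrable (by fun_prop) _ _)
    refine Eventually.of_forall fun s hs => ?_
    rw [← mul_assoc, norm_mul, Real.norm_eq_abs, Real.norm_eq_abs,
      abs_of_nonneg (mul_nonneg (sq_nonneg r) hs.1.le)]
    exact mul_le_mul_of_nonneg_left (hb _) (mul_nonneg (sq_nonneg r) hs.1.le)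
  rw [intervalIntegral.integral_const_mul, hint, Real.norm_eq_abs] at hle
  have : 0 ≤ C / (2 * k) := by positivity
  unfold discMean
  linarith

/-- The integral form of the radial equation `Δu = g(u)` has a global solution when the
nonlinearity is globally Lipschitz and vanishes at `0`. -/
lemma exists_eq_sub_sq_mul_discMean {g : ℝ → ℝ} {L : NNReal} (hg : LipschitzWith L g)
    (hg0 : g 0 = 0) (c : ℝ) :
    ∃ u : ℝ → ℝ, Continuous u ∧
      ∀ r, u r = c - r ^ 2 * discMean (discMean fun t => g (u t)) r := by
  have hgc := hg.continuous
  set k : ℝ := L + 1 with hk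
  have hL : (0 : ℝ) ≤ L := L.2
  have hk0 : 0 < k := by positivity
  let U : BoundedContinuousFunction ℝ ℝ → ℝ → ℝ := fun w t => exp (k * t ^ 2) * w t
  have hUc : ∀ w, Continuous (U w) := fun w => by
    have := w.continuous
    simp only [U]
    fun_prop
  have hgU : ∀ w, Continuous fun t => g (U w t) := fun w => hgc.comp (hUc w)
  let S : BoundedContinuousFunction ℝ ℝ → ℝ → ℝ := fun w r =>
    r ^ 2 * discMean (discMean fun t => g (U w t)) r
  have hSc : ∀ w, Continuous (S w) := fun w => by
    have := continuous_discMean (continuous_discMean (hgU w))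
    simp only [S]
    fun_prop
  have hS : ∀ w₁ w₂ r, |S w₁ r - S w₂ r| ≤ dist w₁ w₂ / 2 * exp (k * r ^ 2) := by
    intro w₁ w₂ r
    have h1 : ∀ t, |g (U w₁ t) - g (U w₂ t)| ≤ (L * dist w₁ w₂) * exp (k * t ^ 2) := by
      intro t
      have h2 := hg.dist_le_mul (U w₁ t) (U w₂ t)
      rw [Real.dist_eq, Real.dist_eq] at h2
      have h3 : |U w₁ t - U w₂ t| ≤ exp (k * t ^ 2) * dist w₁ w₂ := by
        simp only [U]
        rw [← mul_sub, abs_mul, abs_of_pos (exp_pos _), ← Real.dist_eq]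
        gcongr
        exact BoundedContinuousFunction.dist_coe_le_dist t
      calc _ ≤ _ := h2
        _ ≤ L * (exp (k * t ^ 2) * dist w₁ w₂) := by gcongr
        _ = _ := by ring
    have hC : 0 ≤ L * dist w₁ w₂ := by positivity
    have h4 := abs_sq_mul_discMean_le hC hk0 (abs_discMean_le hC hk0.le h1) r
    have h5 : S w₁ r - S w₂ r
        = r ^ 2 * discMean (discMean fun t => g (U w₁ t) - g (U w₂ t)) r := by
      have h6 : (discMean fun t => g (U w₁ t) - g (U w₂ t))
          = fun s => discMean (fun t => g (U w₁ t)) s - discMean (fun t => g (U w₂ t)) s :=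
        funext fun s => discMean_sub (hgU w₁) (hgU w₂) s
      rw [h6, discMean_sub (continuous_discMean (hgU w₁)) (continuous_discMean (hgU w₂))]
      ring
    rw [h5]
    refine h4.trans ?_
    refine mul_le_mul_of_nonneg_right ?_ (exp_pos _).le
    rw [div_le_div_iff₀ (by positivity) two_pos]
    nlinarith [dist_nonneg (x := w₁) (y := w₂)]
  have hS0 : ∀ r, S 0 r = 0 := fun r => by simp [S, U, hg0, discMean]
  let T : BoundedContinuousFunction ℝ ℝ → BoundedContinuousFunction ℝ ℝ := fun w =>
    BoundedContinuousFunction.ofNormedAddCommGroup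
      (fun r => exp (-(k * r ^ 2)) * (c - S w r))
      (by have := hSc w; fun_prop) (|c| + dist w 0 / 2) (by
        intro r
        have h1 := hS w 0 r
        rw [hS0, sub_zero] at h1
        rw [norm_mul, Real.norm_eq_abs, Real.norm_eq_abs, abs_of_pos (exp_pos _), exp_neg,
          inv_mul_le_iff₀ (exp_pos _)]
        have h2 : |c - S w r| ≤ |c| + |S w r| := abs_sub _ _
        have h3 : 1 ≤ exp (k * r ^ 2) := one_le_exp (by positivity)
        nlinarith [abs_nonneg c])
  have hT : ContractingWith (1 / 2) T := by
    refine ⟨by rw [← NNReal.coe_lt_coe]; norm_num, LipschitzWith.of_dist_le_mul fun w₁ w₂ => ?_⟩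
    rw [BoundedContinuousFunction.dist_le (by positivity)]
    intro r
    change dist (exp (-(k * r ^ 2)) * (c - S w₁ r)) (exp (-(k * r ^ 2)) * (c - S w₂ r)) ≤ _
    rw [Real.dist_eq, ← mul_sub, abs_mul, abs_of_pos (exp_pos _), exp_neg,
      inv_mul_le_iff₀ (exp_pos _), sub_sub_sub_cancel_left, abs_sub_comm]
    refine (hS w₁ w₂ r).trans_eq ?_
    push_cast
    ring
  let w := ContractingWith.fixedPoint T hT
  have hw : T w = w := hT.fixedPoint_isFixedPt
  refine ⟨U w, hUc w, fun r => ?_⟩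
  have h1 : w r = exp (-(k * r ^ 2)) * (c - S w r) := by
    conv_lhs => rw [← hw]
    rfl
  change exp (k * r ^ 2) * w r = c - S w r
  rw [h1, ← mul_assoc, ← exp_add]
  simp

/-- `u` is a radial `C²` solution of `Δu = f(u)` in the plane with central value `c`. -/
def IsRadialSolution (f : ℝ → ℝ) (c : ℝ) (u : ℝ → ℝ) : Prop :=
  ContDiffOn ℝ 2 u (Ici 0) ∧ u 0 = c ∧ derivWithin u (Ici 0) 0 = 0 ∧
    ∀ r : ℝ, 0 < r → deriv (deriv u) r + deriv u r / r = -f (u r)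

lemma exists_lipschitzOnWith_Icc {f : ℝ → ℝ} (hf : ContDiff ℝ 1 f) (a b : ℝ) :
    ∃ L : NNReal, LipschitzOnWith L f (Icc a b) :=
  hf.contDiffOn.exists_lipschitzOnWith one_ne_zero (convex_Icc a b) isCompact_Icc

lemma intervalIntegral_odd_eq_zero {f : ℝ → ℝ} (hodd : ∀ x, f (-x) = -f x) (c : ℝ) :
    ∫ t in c..-c, f t = 0 := by
  have h := intervalIntegral.integral_comp_neg f (a := c) (b := -c)
  simp only [hodd, neg_neg, intervalIntegral.integral_neg] at h
  linarith

/-- Global existence for an odd nonlinearity: the energy keeps the solution in `[-c, c]`. -/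
lemma exists_isRadialSolution {f : ℝ → ℝ} (hf : ContDiff ℝ 1 f) (hodd : ∀ x, f (-x) = -f x)
    {c : ℝ} (hc : 0 < c) (hfc : 0 < f c) : ∃ u, IsRadialSolution f c u := by
  obtain ⟨L, hL⟩ := exists_lipschitzOnWith_Icc hf (-c) c
  have hcc : -c ≤ c := by linarith
  set g : ℝ → ℝ := IccExtend hcc ((Icc (-c) c).domRestrict f) with hgdef
  have hg : LipschitzWith (L * 1) g :=
    hL.to_restrict.comp (LipschitzWith.projIcc hcc)
  have hgc : Continuous g := hg.continuous
  have hgf : ∀ x ∈ Icc (-c) c, g x = f x := fun x hx => by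
    rw [hgdef, IccExtend_of_mem hcc _ hx]; rfl
  have hgr : ∀ x, c ≤ x → g x = f c := fun x hx => by
    rw [hgdef, IccExtend_of_right_le hcc _ hx]; rfl
  have hgl : ∀ x, x ≤ -c → g x = -f c := fun x hx => by
    rw [hgdef, IccExtend_of_le_left hcc _ hx, ← hodd]; rfl
  have hg0 : g 0 = 0 := by
    rw [hgf 0 ⟨by linarith, hc.le⟩]
    have := hodd 0
    rw [neg_zero] at this
    linarith
  obtain ⟨u, huc, hu⟩ := exists_eq_sub_sq_mul_discMean hg hg0 c
  have hguc : Continuous fun t => g (u t) := hgc.comp huc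
  set a : ℝ → ℝ := discMean fun t => g (u t) with ha
  have hac : Continuous a := continuous_discMean hguc
  have hu0 : u 0 = c := by simp [hu 0]
  have hu1 : ∀ r, HasDerivAt u (-(r * a r)) r := fun r => by
    have h := (hasDerivAt_sq_mul_discMean hac r).const_sub c
    rwa [← funext hu] at h
  have hu2 : ∀ r, HasDerivAt (fun r => r * a r) (g (u r) - a r) r :=
    hasDerivAt_mul_discMean hguc
  have hd1 : deriv u = fun r => -(r * a r) := funext fun r => (hu1 r).deriv
  have hd2 : deriv (deriv u) = fun r => -(g (u r) - a r) := by
    rw [hd1]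
    exact funext fun r => (hu2 r).neg.deriv
  have hcd : ContDiff ℝ 2 u := by
    rw [show (2 : WithTop ℕ∞) = 1 + 1 by norm_num, contDiff_succ_iff_deriv]
    refine ⟨fun r => (hu1 r).differentiableAt, by simp, ?_⟩
    rw [contDiff_one_iff_deriv, hd2]
    refine ⟨?_, by fun_prop⟩
    rw [hd1]
    exact fun r => (hu2 r).neg.differentiableAt
  have hE : ∀ r, HasDerivAt (fun r => (r * a r) ^ 2 / 2 + ∫ t in c..u r, g t)
      (-(r * a r ^ 2)) r := fun r => by
    have h1 := ((hu2 r).pow 2).div_const 2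
    have h2 : HasDerivAt (fun x => ∫ t in c..x, g t) (g (u r)) (u r) :=
      intervalIntegral.integral_hasDerivAt_right (hgc.intervalIntegrable _ _)
        hgc.stronglyMeasurable.stronglyMeasurableAtFilter hgc.continuousAt
    refine (h1.add (h2.comp r (hu1 r))).congr_deriv ?_
    push_cast
    ring
  have hanti : AntitoneOn (fun r => (r * a r) ^ 2 / 2 + ∫ t in c..u r, g t) (Ici 0) := by
    refine antitoneOn_of_deriv_nonpos (convex_Ici 0)
      (fun r _ => (hE r).continuousAt.continuousWithinAt)
      (fun r _ => (hE r).differentiableAt.differentiableWithinAt) fun r hr => ?_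
    rw [interior_Ici] at hr
    have hr : 0 < r := hr
    rw [(hE r).deriv]
    have : 0 ≤ r * a r ^ 2 := by positivity
    linarith
  have hG : ∀ r, 0 < r → ∫ t in c..u r, g t ≤ 0 := fun r hr => by
    have h := hanti (mem_Ici.2 le_rfl) (mem_Ici.2 hr.le) hr.le
    simp only [hu0, zero_mul, intervalIntegral.integral_same] at h
    nlinarith [sq_nonneg (r * a r)]
  have hbd : ∀ r, 0 < r → u r ∈ Icc (-c) c := fun r hr => by
    have h := hG r hr
    by_contra hn
    rw [mem_Icc, not_and_or, not_le, not_le] at hn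
    rcases hn with hn | hn
    · have h1 : ∫ t in c..-c, g t = 0 := by
        rw [← intervalIntegral_odd_eq_zero hodd c]
        refine intervalIntegral.integral_congr fun t ht => hgf t ?_
        rwa [uIcc_of_ge hcc] at ht
      have h2 : ∫ t in -c..u r, g t = ∫ t in -c..u r, -f c := by
        refine intervalIntegral.integral_congr fun t ht => hgl t ?_
        rw [uIcc_of_ge hn.le] at ht
        exact ht.2
      rw [← intervalIntegral.integral_add_adjacent_intervals (hgc.intervalIntegrable _ (-c))
        (hgc.intervalIntegrable _ _), h1, h2, intervalIntegral.integral_const, smul_eq_mul] at h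
      nlinarith
    · have h2 : ∫ t in c..u r, g t = ∫ t in c..u r, f c := by
        refine intervalIntegral.integral_congr fun t ht => hgr t ?_
        rw [uIcc_of_le hn.le] at ht
        exact ht.1
      rw [h2, intervalIntegral.integral_const, smul_eq_mul] at h
      nlinarith
  refine ⟨u, hcd.contDiffOn, hu0, ?_, fun r hr => ?_⟩
  · rw [(hu1 0).hasDerivWithinAt.derivWithin (uniqueDiffOn_Ici 0 0 (mem_Ici.2 le_rfl))]
    simp
  · rw [hd2, hd1, ← hgf _ (hbd r hr)]
    field_simp
    ring

/-- On `(0, ∞)` a radial solution is twice differentiable, and its first derivative extends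
continuously to `[0, ∞)`. -/
lemma IsRadialSolution.exists_hasDerivAt {f u : ℝ → ℝ} {c : ℝ} (hu : IsRadialSolution f c u) :
    ∃ p : ℝ → ℝ, ContinuousOn p (Ici 0) ∧ p 0 = 0 ∧ (∀ r, 0 < r → HasDerivAt u (p r) r) ∧
      ∀ r, 0 < r → HasDerivAt p (-f (u r) - p r / r) r := by
  obtain ⟨hcd, -, h0, heq⟩ := hu
  have hp : ContDiffOn ℝ 1 (derivWithin u (Ici 0)) (Ici 0) :=
    hcd.derivWithin (uniqueDiffOn_Ici 0) (by norm_num)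
  have hpd : ∀ r, 0 < r → derivWithin u (Ici 0) r = deriv u r := fun r hr =>
    derivWithin_of_mem_nhds (Ici_mem_nhds hr)
  refine ⟨derivWithin u (Ici 0), hp.continuousOn, h0, fun r hr => ?_, fun r hr => ?_⟩
  · rw [hpd r hr]
    exact ((hcd.contDiffAt (Ici_mem_nhds hr)).differentiableAt (by norm_num)).hasDerivAt
  · have h1 := ((hp.contDiffAt (Ici_mem_nhds hr)).differentiableAt (by norm_num)).hasDerivAt
    refine h1.congr_deriv ?_
    have h2 : derivWithin u (Ici 0) =ᶠ[nhds r] deriv u := by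
      filter_upwards [Ioi_mem_nhds hr] with y hy using hpd y hy
    rw [h2.deriv_eq, hpd r hr]
    linarith [heq r hr]

lemma IsRadialSolution.eqOn {f u v : ℝ → ℝ} {c : ℝ} (hf : ContDiff ℝ 1 f)
    (hu : IsRadialSolution f c u) (hv : IsRadialSolution f c v) : EqOn v u (Ici 0) := by
  intro R hR
  have hR : 0 ≤ R := hR
  have hsub : Icc 0 R ⊆ Ici (0 : ℝ) := Icc_subset_Ici_self
  obtain ⟨p, hpc, hp0, hup, hp⟩ := hu.exists_hasDerivAt
  obtain ⟨q, hqc, hq0, hvq, hq⟩ := hv.exists_hasDerivAt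
  have huc := hu.1.continuousOn.mono hsub
  have hvc := hv.1.continuousOn.mono hsub
  obtain ⟨M₁, hM₁⟩ := isCompact_Icc.exists_bound_of_continuousOn huc
  obtain ⟨M₂, hM₂⟩ := isCompact_Icc.exists_bound_of_continuousOn hvc
  obtain ⟨L, hL⟩ := exists_lipschitzOnWith_Icc hf (-max M₁ M₂) (max M₁ M₂)
  let D : ℝ → ℝ := fun r =>
    exp (-((1 + L) * r)) * ((u r - v r) ^ 2 + (p r - q r) ^ 2)
  have hD : ∀ r, 0 < r → HasDerivAt D
      (exp (-((1 + L) * r)) * (-(1 + L) * ((u r - v r) ^ 2 + (p r - q r) ^ 2)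
        + (2 * (u r - v r) * (p r - q r)
          + 2 * (p r - q r) * ((-f (u r) - p r / r) - (-f (v r) - q r / r))))) r := by
    intro r hr
    have h1 : HasDerivAt (fun r => -((1 + (L : ℝ)) * r)) (-(1 + L)) r := by
      exact ((hasDerivAt_id r).const_mul (1 + (L : ℝ))).neg.congr_deriv (by ring)
    have h2 := (((hup r hr).sub (hvq r hr)).pow 2).add (((hp r hr).sub (hq r hr)).pow 2)
    refine (h1.exp.mul h2).congr_deriv ?_
    simp only [Pi.add_apply, Pi.sub_apply, Pi.pow_apply]
    push_cast
    ring
  have hanti : AntitoneOn D (Icc 0 R) := by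
    refine antitoneOn_of_deriv_nonpos (convex_Icc 0 R) ?_ ?_ ?_
    · have := hpc.mono hsub
      have := hqc.mono hsub
      simp only [D]
      fun_prop
    · rw [interior_Icc]
      exact fun r hr => (hD r hr.1).differentiableAt.differentiableWithinAt
    · rw [interior_Icc]
      intro r hr
      have hr0 := hr.1
      rw [(hD r hr0).deriv]
      refine mul_nonpos_of_nonneg_of_nonpos (exp_pos _).le ?_
      have hmem : r ∈ Icc 0 R := Ioo_subset_Icc_self hr
      have h1 := hL.dist_le_mul (u r)
        (abs_le.1 ((hM₁ r hmem).trans (le_max_left _ _))) (v r)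
        (abs_le.1 ((hM₂ r hmem).trans (le_max_right _ _)))
      rw [Real.dist_eq, Real.dist_eq] at h1
      have h2 : -((p r - q r) * (f (u r) - f (v r))) ≤ L * (|u r - v r| * |p r - q r|) := by
        calc _ ≤ |(p r - q r) * (f (u r) - f (v r))| := neg_le_abs _
          _ = |p r - q r| * |f (u r) - f (v r)| := abs_mul _ _
          _ ≤ |p r - q r| * (L * |u r - v r|) := by gcongr
          _ = _ := by ring
      have h3 : (u r - v r) * (p r - q r) ≤ |u r - v r| * |p r - q r| := by
        rw [← abs_mul]; exact le_abs_self _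
      have h4 : 2 * (|u r - v r| * |p r - q r|) ≤ (u r - v r) ^ 2 + (p r - q r) ^ 2 := by
        rw [← sq_abs (u r - v r), ← sq_abs (p r - q r), ← mul_assoc]
        exact two_mul_le_add_sq _ _
      have h5 : 2 * (p r - q r) * ((-f (u r) - p r / r) - (-f (v r) - q r / r))
          = 2 * -((p r - q r) * (f (u r) - f (v r))) - 2 * ((p r - q r) ^ 2 / r) := by
        ring
      have h6 : 0 ≤ (p r - q r) ^ 2 / r := by positivity
      have h7 := mul_le_mul_of_nonneg_left h4 L.2
      rw [h5]
      change (L : ℝ) * _ ≤ L * _ at h7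
      linarith
  have h0 : D 0 = 0 := by simp [D, hu.2.1, hv.2.1, hp0, hq0]
  have h1 : D R ≤ 0 := h0 ▸ hanti ⟨le_rfl, hR⟩ ⟨hR, le_rfl⟩ hR
  have h2 : (u R - v R) ^ 2 + (p R - q R) ^ 2 ≤ 0 :=
    nonpos_of_mul_nonpos_right h1 (exp_pos _)
  have h3 : (u R - v R) ^ 2 = 0 :=
    le_antisymm (by linarith [sq_nonneg (p R - q R)]) (sq_nonneg _)
  linarith [pow_eq_zero_iff two_ne_zero |>.1 h3]

/-- For λ ≥ 0, β ≥ 0 and γ > 0, there exists a unique function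
u ∈ C²([0,∞)) with u(0) = γ, u'(0) = 0 solving u'' + u'/r = −(λu + βu e^{u²}) for r > 0;
i.e. the radial solution of Δu = λu + βu e^{u²} (with Δ = −div∇) with central value γ
is globally defined. Uniqueness is up to the values on [0,∞). -/
theorem statement0 (lam beta gam : ℝ) (hlam : 0 ≤ lam) (hbeta : 0 ≤ beta) (hgam : 0 < gam) :
    ∃ u : ℝ → ℝ,
      (ContDiffOn ℝ 2 u (Set.Ici 0) ∧ u 0 = gam ∧ derivWithin u (Set.Ici 0) 0 = 0 ∧
        ∀ r : ℝ, 0 < r →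
          deriv (deriv u) r + deriv u r / r
            = -(lam * u r + beta * u r * Real.exp ((u r) ^ 2))) ∧
      ∀ v : ℝ → ℝ,
        (ContDiffOn ℝ 2 v (Set.Ici 0) ∧ v 0 = gam ∧ derivWithin v (Set.Ici 0) 0 = 0 ∧
          ∀ r : ℝ, 0 < r →
            deriv (deriv v) r + deriv v r / r
              = -(lam * v r + beta * v r * Real.exp ((v r) ^ 2))) →
        Set.EqOn v u (Set.Ici 0) := by
  let f : ℝ → ℝ := fun x => lam * x + beta * x * Real.exp (x ^ 2)
  have hf : ContDiff ℝ 1 f := by fun_prop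
  have hodd : ∀ x, f (-x) = -f x := fun x => by simp only [f, neg_sq]; ring
  have hfc : 0 ≤ f gam := by positivity
  have hex : ∃ u, IsRadialSolution f gam u := by
    rcases hfc.lt_or_eq with hpos | hzero
    · exact exists_isRadialSolution hf hodd hgam hpos
    · have h1 : 0 ≤ lam * gam := by positivity
      have h2 : 0 ≤ beta * gam * Real.exp (gam ^ 2) := by positivity
      have h3 : lam * gam + beta * gam * Real.exp (gam ^ 2) = 0 := hzero.symm
      have hl : lam = 0 := by
        have : lam * gam = 0 := by linarith
        simpa [hgam.ne'] using this
      have hb : beta = 0 := by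
        have : beta * gam * Real.exp (gam ^ 2) = 0 := by linarith
        simpa [hgam.ne'] using this
      refine ⟨fun _ => gam, contDiffOn_const, rfl, by simp, fun r _ => ?_⟩
      simp [f, hl, hb]
  obtain ⟨u, hu⟩ := hex
  exact ⟨u, hu, fun v hv => hu.eqOn hf hv⟩
end

section
/- Let λ ≥ 0, β > 0 and γ > 0, and let u be the global radial solution of u''(r) + u'(r)/r = −(λ u(r) + β u(r) exp(u(r)²)) with u(0) = γ, u'(0) = 0. Then there exists R ∈ (0, +∞) such that u > 0 on [0, R), u(R) = 0 and u'(R) < 0; i.e. u has a finite first zero, at which its derivative is strictly negative. -/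
open Real Set Filter MeasureTheory

/-- The divergence form of the radial equation `u'' + u'/r = -F`. -/
lemma hasDerivAt_mul_deriv_of_radial_ode {u F : ℝ → ℝ}
    (hreg : ContDiffOn ℝ 2 u (Ici 0))
    (hode : ∀ r : ℝ, 0 < r → deriv (deriv u) r + deriv u r / r = -F r) {x : ℝ} (hx : 0 < x) :
    HasDerivAt (fun y => y * deriv u y) (-(x * F x)) x := by
  have hdd : DifferentiableAt ℝ (deriv u) x :=
    (((hreg.mono Ioi_subset_Ici_self).deriv_of_isOpen (m := 1) isOpen_Ioi
      (by norm_num)).differentiableOn (by norm_num)).differentiableAt (Ioi_mem_nhds hx)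
  have hprod : HasDerivAt (fun y => y * deriv u y) (1 * deriv u x + x * deriv (deriv u) x) x :=
    (hasDerivAt_id x).mul hdd.hasDerivAt
  have hmul : 1 * deriv u x + x * deriv (deriv u) x = -(x * F x) := by
    rw [← mul_neg, ← hode x hx]
    field_simp
    ring
  rwa [hmul] at hprod

/-- If `r u'(r)` has negative derivative `-r F(r)` on `(0, R)`, then `u'` is negative on `(0, R]`. -/
lemma deriv_neg_of_radial_ode {u F : ℝ → ℝ} {R : ℝ}
    (hreg : ContDiffOn ℝ 2 u (Ici 0))
    (hode : ∀ r : ℝ, 0 < r → deriv (deriv u) r + deriv u r / r = -F r)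
    (hF : ∀ r ∈ Ioo 0 R, 0 < F r) {r : ℝ} (hr : r ∈ Ioc 0 R) : deriv u r < 0 := by
  have hderiv : ∀ x : ℝ, 0 < x → derivWithin u (Ici 0) x = deriv u x := fun x hx =>
    derivWithin_of_mem_nhds (Ici_mem_nhds hx)
  have hcont : ContinuousOn (fun x => x * derivWithin u (Ici 0) x) (Icc 0 R) :=
    (continuousOn_id.mul (hreg.continuousOn_derivWithin (uniqueDiffOn_Ici 0)
      (by norm_num))).mono Icc_subset_Ici_self
  have hanti : StrictAntiOn (fun x => x * derivWithin u (Ici 0) x) (Icc 0 R) := by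
    refine strictAntiOn_of_deriv_neg (convex_Icc 0 R) hcont fun x hx => ?_
    rw [interior_Icc] at hx
    have hx0 : 0 < x := hx.1
    have hloc : (fun y => y * derivWithin u (Ici 0) y) =ᶠ[nhds x] fun y => y * deriv u y := by
      filter_upwards [Ioi_mem_nhds hx0] with y hy
      rw [hderiv y hy]
    rw [hloc.deriv_eq, (hasDerivAt_mul_deriv_of_radial_ode hreg hode hx0).deriv]
    exact neg_neg_of_pos (mul_pos hx0 (hF x hx))
  have hlt := hanti ⟨le_rfl, hr.1.le.trans hr.2⟩ ⟨hr.1.le, hr.2⟩ hr.1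
  simp only [zero_mul, hderiv r hr.1] at hlt
  exact neg_of_mul_neg_right hlt hr.1.le

/-- A radial supersolution on the plane cannot stay positive: `r u'(r) ≤ u'(1) < 0` for `1 ≤ r`
forces `u` to decrease at least logarithmically. -/
lemma exists_nonpos_of_radial_ode {u F : ℝ → ℝ}
    (hreg : ContDiffOn ℝ 2 u (Ici 0))
    (hode : ∀ r : ℝ, 0 < r → deriv (deriv u) r + deriv u r / r = -F r)
    (hF : ∀ r, 0 < r → 0 < u r → 0 < F r) : ∃ r, 0 ≤ r ∧ u r ≤ 0 := by
  by_contra! hpos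
  have hFpos : ∀ r, 0 < r → 0 < F r := fun r hr => hF r hr (hpos r hr.le)
  have hd1 : deriv u 1 < 0 :=
    deriv_neg_of_radial_ode (R := 1) hreg hode (fun r hr => hFpos r hr.1) ⟨one_pos, le_rfl⟩
  have hdu : ∀ x : ℝ, 0 < x → HasDerivAt u (deriv u x) x := fun x hx =>
    ((hreg.differentiableOn (by norm_num)).differentiableAt (Ici_mem_nhds hx)).hasDerivAt
  have hprod : ∀ x : ℝ, 0 < x → HasDerivAt (fun y => y * deriv u y) (-(x * F x)) x :=
    fun x hx => hasDerivAt_mul_deriv_of_radial_ode hreg hode hx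
  have hanti : AntitoneOn (fun y => y * deriv u y) (Ici 1) := by
    refine antitoneOn_of_deriv_nonpos (convex_Ici 1)
      (fun x hx => (hprod x (one_pos.trans_le hx)).continuousAt.continuousWithinAt)
      (fun x hx => ?_) fun x hx => ?_
    all_goals
      rw [interior_Ici] at hx
      have hx0 : 0 < x := one_pos.trans hx
    · exact (hprod x hx0).differentiableAt.differentiableWithinAt
    · rw [(hprod x hx0).deriv]
      exact neg_nonpos.2 (mul_pos hx0 (hFpos x hx0)).le
  have hlog : ∀ x : ℝ, 0 < x →
      HasDerivAt (fun y => u y - deriv u 1 * Real.log y) (deriv u x - deriv u 1 * x⁻¹) x :=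
    fun x hx => (hdu x hx).sub ((Real.hasDerivAt_log hx.ne').const_mul _)
  have hanti' : AntitoneOn (fun y => u y - deriv u 1 * Real.log y) (Ici 1) := by
    refine antitoneOn_of_deriv_nonpos (convex_Ici 1)
      (fun x hx => (hlog x (one_pos.trans_le hx)).continuousAt.continuousWithinAt)
      (fun x hx => ?_) fun x hx => ?_
    all_goals
      rw [interior_Ici] at hx
      have hx0 : 0 < x := one_pos.trans hx
    · exact (hlog x hx0).differentiableAt.differentiableWithinAt
    · rw [(hlog x hx0).deriv, sub_nonpos, ← div_eq_mul_inv, le_div_iff₀ hx0, mul_comm]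
      simpa using hanti self_mem_Ici (mem_Ici.2 (le_of_lt hx)) (le_of_lt hx)
  have hexp : 1 ≤ Real.exp (u 1 / -deriv u 1) :=
    Real.one_le_exp (div_nonneg (hpos 1 zero_le_one).le (neg_nonneg.2 hd1.le))
  have hle := hanti' self_mem_Ici hexp hexp
  have hcancel : deriv u 1 * (u 1 / -deriv u 1) = -u 1 := by
    have := hd1.ne
    field_simp
  simp only [Real.log_exp, Real.log_one, hcancel] at hle
  linarith [hpos _ (zero_le_one.trans hexp)]

/-- For λ ≥ 0, β > 0, γ > 0, the global C² radial solution of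
u'' + u'/r = −(λu + βu e^{u²}) with u(0) = γ, u'(0) = 0 has a finite first zero R,
with u > 0 on [0,R), u(R) = 0 and u'(R) < 0. -/
theorem statement1 (lam beta gam : ℝ) (hlam : 0 ≤ lam) (hbeta : 0 < beta) (hgam : 0 < gam)
    (u : ℝ → ℝ)
    (hreg : ContDiffOn ℝ 2 u (Set.Ici 0))
    (hu0 : u 0 = gam)
    (hu'0 : derivWithin u (Set.Ici 0) 0 = 0)
    (hode : ∀ r : ℝ, 0 < r →
      deriv (deriv u) r + deriv u r / r
        = -(lam * u r + beta * u r * Real.exp ((u r) ^ 2))) :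
    ∃ R : ℝ, 0 < R ∧ (∀ r ∈ Set.Ico (0:ℝ) R, 0 < u r) ∧ u R = 0 ∧ deriv u R < 0 := by
  have hF : ∀ r, 0 < u r → 0 < lam * u r + beta * u r * Real.exp ((u r) ^ 2) :=
    fun r hr => by positivity
  have hcont := hreg.continuousOn
  obtain ⟨r₀, hr₀⟩ := exists_nonpos_of_radial_ode hreg hode fun r _ => hF r
  have hclosed : IsClosed (Ici 0 ∩ u ⁻¹' Iic 0) :=
    hcont.preimage_isClosed_of_isClosed isClosed_Ici isClosed_Iic
  have hbdd : BddBelow (Ici 0 ∩ u ⁻¹' Iic 0) := ⟨0, fun x hx => hx.1⟩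
  obtain ⟨R, ⟨hR0, hR⟩, hmin⟩ : ∃ R, IsLeast (Ici 0 ∩ u ⁻¹' Iic 0) R :=
    ⟨_, hclosed.isLeast_csInf ⟨r₀, hr₀⟩ hbdd⟩
  simp only [mem_Ici, mem_preimage, mem_Iic] at hR0 hR
  have hRpos : 0 < R := hR0.lt_of_ne (by rintro rfl; linarith)
  have hpos : ∀ r ∈ Ico (0 : ℝ) R, 0 < u r := fun r hr => by
    by_contra! h
    exact (hmin ⟨hr.1, h⟩).not_gt hr.2
  refine ⟨R, hRpos, hpos, ?_, deriv_neg_of_radial_ode hreg hode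
    (fun r hr => hF r (hpos r ⟨hr.1.le, hr.2⟩)) ⟨hRpos, le_rfl⟩⟩
  obtain ⟨x, hx, hux⟩ := intermediate_value_Icc' hR0 (hcont.mono Icc_subset_Ici_self)
    ⟨hR, (hu0 ▸ hgam).le⟩
  rwa [← le_antisymm hx.2 (hmin ⟨hx.1, hux.le⟩)]
end
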